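/- arXiv:math/0105043 — 2 statements merged into one kernel-verified Lean document; each statement's English description precedes it below -/
import Mathlib

section
/- Let λ > λ₀. There exist ε₀ > 0, M₀ > 0 and M₀' > 0 such that for every ε ∈ (0, ε₀], the 2π-periodic solutions u₁ and u₅ of (∗) (u₁ the unique one with u₁ < −√(λ/3) everywhere, u₅(t) = −u₁(t+π)) satisfy, for all t ∈ ℝ: |u₁(t) − U̲(t)| < M₀·ε², |u₅(t) − Ū(t)| < M₀·ε², |u₁'(t) − U̲'(t)| < M₀'·ε, and |u₅'(t) − Ū'(t)| < M₀'·ε. -/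
open Real Set

/-- A twice differentiable function has nonpositive second derivative at a local maximum. -/
theorem nonpos_of_isLocalMax {w v : ℝ → ℝ} {r x : ℝ} (hw : ∀ t, HasDerivAt w (v t) t)
    (hv : HasDerivAt v r x) (hx : IsLocalMax w x) : r ≤ 0 := by
  by_contra! hr
  have hd : deriv w = v := funext fun t => (hw t).deriv
  have h0 : deriv w x = 0 := hx.deriv_eq_zero
  have hdd : deriv (deriv w) x = r := by rw [hd]; exact hv.deriv
  have hmin : IsLocalMin w x :=
    isLocalMin_of_deriv_deriv_pos (by rw [hdd]; exact hr) h0 (hw x).continuousAt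
  have hc : w =ᶠ[nhds x] fun _ => w x := by
    filter_upwards [hx, hmin] with y h1 h2 using le_antisymm h1 h2
  have h2 : deriv w =ᶠ[nhds x] deriv fun _ => w x := hc.deriv
  have h3 := h2.deriv_eq
  rw [hdd] at h3
  simp at h3
  linarith

/-- A continuous periodic function attains its supremum. -/
theorem exists_forall_le_of_periodic {w : ℝ → ℝ} {c : ℝ} (hc : 0 < c) (hw : Continuous w)
    (hp : Function.Periodic w c) : ∃ x, ∀ t, w t ≤ w x := by
  obtain ⟨x, -, hx⟩ := isCompact_Icc.exists_isMaxOn (nonempty_Icc.2 hc.le) hw.continuousOn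
  refine ⟨x, fun t => ?_⟩
  obtain ⟨y, hy, hty⟩ := hp.exists_mem_Ico₀ hc t
  exact hty ▸ hx (Ico_subset_Icc_self hy)

/-- One-sided maximum principle for periodic solutions of `e w'' = q w + r` with `q ≥ m > 0`. -/
theorem le_div_of_periodic {w v z q r : ℝ → ℝ} {c e m R : ℝ} (hc : 0 < c) (he : 0 < e)
    (hm : 0 < m) (hR : 0 ≤ R) (hw : ∀ t, HasDerivAt w (v t) t) (hv : ∀ t, HasDerivAt v (z t) t)
    (hp : Function.Periodic w c) (hq : ∀ t, m ≤ q t) (hr : ∀ t, -R ≤ r t)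
    (h : ∀ t, e * z t = q t * w t + r t) (t : ℝ) : w t ≤ R / m := by
  have hcont : Continuous w := continuous_iff_continuousAt.2 fun t => (hw t).continuousAt
  obtain ⟨x, hx⟩ := exists_forall_le_of_periodic hc hcont hp
  refine (hx t).trans ?_
  have hz : z x ≤ 0 := nonpos_of_isLocalMax hw (hv x) (Filter.Eventually.of_forall hx)
  by_contra! hlt
  have hpos : 0 < w x := (div_nonneg hR hm.le).trans_lt hlt
  have h1 : R < w x * m := (div_lt_iff₀ hm).1 hlt
  nlinarith [h x, hr x, mul_le_mul_of_nonneg_right (hq x) hpos.le,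
    mul_nonpos_of_nonneg_of_nonpos he.le hz]

/-- Maximum principle for periodic solutions of `e w'' = q w + r` with `q ≥ m > 0`. -/
theorem abs_le_div_of_periodic {w v z q r : ℝ → ℝ} {c e m R : ℝ} (hc : 0 < c) (he : 0 < e)
    (hm : 0 < m) (hw : ∀ t, HasDerivAt w (v t) t) (hv : ∀ t, HasDerivAt v (z t) t)
    (hp : Function.Periodic w c) (hq : ∀ t, m ≤ q t) (hr : ∀ t, |r t| ≤ R)
    (h : ∀ t, e * z t = q t * w t + r t) (t : ℝ) : |w t| ≤ R / m := by
  have hR : 0 ≤ R := (abs_nonneg _).trans (hr 0)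
  refine abs_le'.2 ⟨le_div_of_periodic hc he hm hR hw hv hp hq
    (fun t => (abs_le.1 (hr t)).1) h t, ?_⟩
  refine le_div_of_periodic (w := fun t => -w t) (v := fun t => -v t) (z := fun t => -z t)
    (r := fun t => -r t) hc he hm hR (fun t => (hw t).neg) (fun t => (hv t).neg)
    (fun t => by simp only [hp t]) hq (fun t => by linarith [(abs_le.1 (hr t)).2])
    (fun t => by linarith [h t]) t

/-- Landau's interpolation inequality at scale `ε`. -/
theorem abs_deriv_le_of_abs_le {w v z : ℝ → ℝ} {ε M K : ℝ} (hε : 0 < ε)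
    (hw : ∀ t, HasDerivAt w (v t) t) (hv : ∀ t, HasDerivAt v (z t) t)
    (hM : ∀ t, |w t| ≤ M * ε ^ 2) (hK : ∀ t, |z t| ≤ K) (t : ℝ) : |v t| ≤ (2 * M + K) * ε := by
  obtain ⟨x, hx, hxv⟩ := exists_hasDerivAt_eq_slope w v (lt_add_of_pos_right t hε)
    (fun s _ => (hw s).continuousAt.continuousWithinAt) (fun s _ => hw s)
  have h1 : v x * ε = w (t + ε) - w t := by
    rw [hxv, add_sub_cancel_left, div_mul_cancel₀ _ hε.ne']
  have h2 : |v t - v x| ≤ K * |t - x| :=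
    convex_univ.norm_image_sub_le_of_norm_hasDerivWithin_le (fun s _ => (hv s).hasDerivWithinAt)
      (fun s _ => hK s) (mem_univ x) (mem_univ t)
  have hK0 : 0 ≤ K := (abs_nonneg _).trans (hK 0)
  have h3 : |t - x| ≤ ε := abs_le.2 ⟨by linarith [hx.2], by linarith [hx.1]⟩
  have h4 : |v x| * ε ≤ 2 * M * ε * ε := by
    rw [← abs_of_pos hε, ← abs_mul, abs_of_pos hε, h1]
    calc |w (t + ε) - w t| ≤ |w (t + ε)| + |w t| := abs_sub _ _
      _ ≤ M * ε ^ 2 + M * ε ^ 2 := add_le_add (hM _) (hM _)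
      _ = 2 * M * ε * ε := by ring
  have h5 : |v x| ≤ 2 * M * ε := le_of_mul_le_mul_right h4 hε
  calc |v t| = |(v t - v x) + v x| := by ring_nf
    _ ≤ |v t - v x| + |v x| := abs_add_le _ _
    _ ≤ K * ε + 2 * M * ε :=
      add_le_add (h2.trans (mul_le_mul_of_nonneg_left h3 hK0)) h5
    _ = (2 * M + K) * ε := by ring

/-- Above the threshold, the cubic exceeds `1` at some point left of its local maximum. -/
theorem exists_gt_one_lt_cubic {a : ℝ} (ha : 1 < 2 * a ^ 3) :
    ∃ p, a < p ∧ 1 < 3 * a ^ 2 * p - p ^ 3 := by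
  have hc : ContinuousAt (fun p : ℝ => 3 * a ^ 2 * p - p ^ 3) a := by fun_prop
  have h1 : ∀ᶠ p in nhds a, 1 < 3 * a ^ 2 * p - p ^ 3 :=
    hc.eventually (lt_mem_nhds (by ring_nf; linarith))
  obtain ⟨p, hp, hap⟩ := ((h1.filter_mono nhdsWithin_le_nhds).and
    (self_mem_nhdsWithin (a := a) (s := Ioi a))).exists
  exact ⟨p, hap, hp⟩

/-- The cubic `x ^ 3 - 3 * a ^ 2 * x` exceeds `1` to the right of `3 * a + 1`. -/
theorem one_lt_cubic {a x : ℝ} (ha : 0 < a) (hx : 3 * a + 1 < x) : 1 < x ^ 3 - 3 * a ^ 2 * x := by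
  have h1 : 1 < x := by linarith
  have h2 : 1 ≤ x ^ 2 - 3 * a ^ 2 := by nlinarith [mul_pos ha ha]
  nlinarith [mul_le_mul_of_nonneg_left h2 (zero_le_one.trans h1.le)]

/-- The least root of the cubic lies in a fixed interval left of `-a`. -/
theorem least_root_mem_Icc {a p c y : ℝ} (ha : 0 < a) (hp : 1 < 3 * a ^ 2 * p - p ^ 3)
    (hc : |c| ≤ 1) (hy : y ^ 3 - 3 * a ^ 2 * y + c = 0)
    (hmin : ∀ x : ℝ, x ^ 3 - 3 * a ^ 2 * x + c = 0 → y ≤ x) : y ∈ Icc (-(3 * a + 1)) (-p) := by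
  obtain ⟨hc1, hc2⟩ := abs_le.1 hc
  have hpL : p ≤ 3 * a + 1 := by
    by_contra! h
    linarith [one_lt_cubic ha h, ha]
  constructor
  · by_contra! h
    nlinarith [one_lt_cubic ha (lt_neg.1 h)]
  · have hcont : ContinuousOn (fun x : ℝ => x ^ 3 - 3 * a ^ 2 * x + c)
        (Icc (-(3 * a + 1)) (-p)) := by fun_prop
    obtain ⟨x, hx, hx0⟩ := intermediate_value_Icc (neg_le_neg hpL) hcont
      (show (0 : ℝ) ∈ Icc _ _ from ⟨by nlinarith [mul_pos ha ha, mul_pos ha (mul_pos ha ha)],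
        by nlinarith⟩)
    exact (hmin x hx0).trans hx.2

/-- Lower bound for the divided difference of the cubic left of `-a`. -/
theorem le_dividedDifference {a p x y : ℝ} (ha : 0 < a) (hx : x ≤ -a) (hy : y ≤ -p)
    (hap : a < p) : 2 * a * (p - a) ≤ x ^ 2 + x * y + y ^ 2 - 3 * a ^ 2 := by
  nlinarith [mul_nonneg (sub_nonneg.2 hx) ha.le,
    mul_nonneg (sub_nonneg.2 hx) (sub_nonneg.2 hx), mul_nonneg (sub_nonneg.2 hx) (sub_nonneg.2 hy),
    mul_nonneg (sub_nonneg.2 hy) (sub_nonneg.2 hy), mul_nonneg (sub_nonneg.2 hy) ha.le,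
    mul_pos ha (sub_pos.2 hap), mul_nonneg (sub_nonneg.2 hx) (sub_pos.2 hap).le,
    mul_nonneg (sub_nonneg.2 hy) (sub_pos.2 hap).le]

/-- A branch of roots of `x ^ 3 - 3 * a ^ 2 * x + cos t` that stays left of `-p < -a` is
differentiable. -/
theorem hasDerivAt_root {a p : ℝ} {U : ℝ → ℝ} (ha : 0 < a) (hap : a < p) (hU : ∀ t, U t ≤ -p)
    (hroot : ∀ t, U t ^ 3 - 3 * a ^ 2 * U t + cos t = 0) (t : ℝ) :
    HasDerivAt U (sin t / (3 * U t ^ 2 - 3 * a ^ 2)) t := by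
  have hm : 0 < 2 * a * (p - a) := by have := sub_pos.2 hap; positivity
  have hQ : ∀ s, 2 * a * (p - a) ≤ U s ^ 2 + U s * U t + U t ^ 2 - 3 * a ^ 2 := fun s =>
    le_dividedDifference ha (by linarith [hU s]) (hU t) hap
  have heq : ∀ s, (U s - U t) * (U s ^ 2 + U s * U t + U t ^ 2 - 3 * a ^ 2) =
      -(cos s - cos t) := fun s => by linear_combination hroot s - hroot t
  have hdist : ∀ s, U s = U t + -(cos s - cos t) /
      (U s ^ 2 + U s * U t + U t ^ 2 - 3 * a ^ 2) := fun s => by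
    rw [← heq s, mul_div_cancel_right₀ _ (hm.trans_le (hQ s)).ne']; ring
  have hcont : ContinuousAt U t := by
    rw [ContinuousAt, tendsto_iff_dist_tendsto_zero]
    have hlim : Filter.Tendsto (fun s => |cos s - cos t| / (2 * a * (p - a))) (nhds t)
        (nhds 0) := by
      have : ContinuousAt (fun s => |cos s - cos t| / (2 * a * (p - a))) t := by fun_prop
      simpa [ContinuousAt] using this
    refine squeeze_zero (fun s => dist_nonneg) (fun s => ?_) hlim
    rw [Real.dist_eq, le_div_iff₀ hm, ← abs_neg (cos s - cos t), ← heq s, abs_mul]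
    exact mul_le_mul_of_nonneg_left ((hQ s).trans (le_abs_self _)) (abs_nonneg _)
  rw [hasDerivAt_iff_tendsto_slope]
  have hcos := hasDerivAt_iff_tendsto_slope.1 (hasDerivAt_cos t)
  have hden : Filter.Tendsto (fun s => U s ^ 2 + U s * U t + U t ^ 2 - 3 * a ^ 2)
      (nhdsWithin t {t}ᶜ) (nhds (3 * U t ^ 2 - 3 * a ^ 2)) := by
    have h : ContinuousAt (fun s => U s ^ 2 + U s * U t + U t ^ 2 - 3 * a ^ 2) t := by fun_prop
    have h' := h.tendsto.mono_left (nhdsWithin_le_nhds (s := {t}ᶜ))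
    convert h' using 2
    ring
  have hne : 3 * U t ^ 2 - 3 * a ^ 2 ≠ 0 := by nlinarith [hQ t]
  have hlim := hcos.neg.div hden hne
  rw [neg_neg] at hlim
  refine hlim.congr fun s => ?_
  have hs := (hm.trans_le (hQ s)).ne'
  simp only [slope_def_field, Pi.div_apply]
  rw [← neg_div, ← heq s, div_right_comm, mul_div_cancel_right₀ _ hs]

/-- Uniform `O(ε²)` and `O(ε)` bounds for the distance of a periodic solution below `-a` and of its
derivative from the least root of the cubic `x ^ 3 - 3 * a ^ 2 * x + cos t`. -/
theorem exists_bound_sub_least_root {a : ℝ} {U : ℝ → ℝ} (ha : 0 < a) (ha1 : 1 < 2 * a ^ 3)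
    (hroot : ∀ t, U t ^ 3 - 3 * a ^ 2 * U t + cos t = 0)
    (hmin : ∀ t y, y ^ 3 - 3 * a ^ 2 * y + cos t = 0 → U t ≤ y) :
    ∃ M > 0, ∃ M' > 0, ∀ ε ∈ Ioc (0 : ℝ) 1, ∀ u : ℝ → ℝ, ContDiff ℝ 2 u →
      (∀ t, ε ^ 2 * deriv (deriv u) t = u t ^ 3 - 3 * a ^ 2 * u t + cos t) →
      Function.Periodic u (2 * π) → (∀ t, u t < -a) →
      ∀ t, |u t - U t| < M * ε ^ 2 ∧ |deriv u t - deriv U t| < M' * ε := by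
  obtain ⟨p, hap, hp⟩ := exists_gt_one_lt_cubic ha1
  set L := 3 * a + 1
  have hUI : ∀ t, U t ∈ Icc (-L) (-p) := fun t =>
    least_root_mem_Icc ha hp (abs_cos_le_one t) (hroot t) (hmin t)
  have hUper : Function.Periodic U (2 * π) := fun t => le_antisymm
    (hmin _ _ (by rw [cos_add_two_pi]; exact hroot t))
    (hmin _ _ (by rw [← cos_add_two_pi]; exact hroot _))
  set D : ℝ → ℝ := fun t => 3 * U t ^ 2 - 3 * a ^ 2
  set V : ℝ → ℝ := fun t => sin t / D t
  set A : ℝ → ℝ := fun t => (cos t * D t - sin t * (6 * U t * V t)) / D t ^ 2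
  have hUV : ∀ t, HasDerivAt U (V t) t := hasDerivAt_root ha hap (fun t => (hUI t).2) hroot
  have hD : ∀ t, D t ≠ 0 := fun t => by
    have := (hUI t).2
    have : 0 < D t := by simp only [D]; nlinarith
    exact this.ne'
  have hDd : ∀ t, HasDerivAt D (6 * U t * V t) t := fun t => by
    have h := (((hUV t).pow 2).const_mul 3).sub_const (3 * a ^ 2)
    exact h.congr_deriv (by norm_num; ring)
  have hVA : ∀ t, HasDerivAt V (A t) t := fun t => (hasDerivAt_sin t).div (hDd t) (hD t)
  have hUc : Continuous U := continuous_iff_continuousAt.2 fun t => (hUV t).continuousAt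
  have hVc : Continuous V := continuous_iff_continuousAt.2 fun t => (hVA t).continuousAt
  have hDc : Continuous D := continuous_iff_continuousAt.2 fun t => (hDd t).continuousAt
  have hAc : Continuous A := by
    refine Continuous.div (by fun_prop) (by fun_prop) fun t => pow_ne_zero 2 (hD t)
  have hAper : Function.Periodic A (2 * π) := fun t => by
    simp only [A, V, D, hUper t, sin_add_two_pi, cos_add_two_pi]
  obtain ⟨x, hx⟩ := exists_forall_le_of_periodic two_pi_pos hAc.abs
    (fun t => by simp only [hAper t])
  set K := |A x|
  have hK0 : 0 ≤ K := abs_nonneg _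
  set m := 2 * a * (p - a)
  have hm : 0 < m := by have := sub_pos.2 hap; positivity
  set N := K / m
  have hN : 0 ≤ N := div_nonneg hK0 hm.le
  set B := 3 * (L + N) ^ 2 * N + K
  have hB : 0 ≤ B := by positivity
  refine ⟨N + 1, by positivity, 2 * N + B + 1, by positivity, ?_⟩
  rintro ε ⟨hε, hε1⟩ u hu hode huper hua
  have hud : ∀ t, HasDerivAt u (deriv u t) t := fun t =>
    (hu.differentiable (by norm_num) t).hasDerivAt
  have hudd : ∀ t, HasDerivAt (deriv u) (deriv (deriv u) t) t := fun t =>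
    ((contDiff_succ_iff_deriv (n := 1)).1 hu).2.2.differentiable (by norm_num) t |>.hasDerivAt
  have hε2 : 0 < ε ^ 2 := pow_pos hε 2
  have hw : ∀ t, HasDerivAt (fun s => u s - U s) (deriv u t - V t) t := fun t =>
    (hud t).sub (hUV t)
  have hv : ∀ t, HasDerivAt (fun s => deriv u s - V s) (deriv (deriv u) t - A t) t := fun t =>
    (hudd t).sub (hVA t)
  have heq : ∀ t, ε ^ 2 * (deriv (deriv u) t - A t) =
      (u t ^ 2 + u t * U t + U t ^ 2 - 3 * a ^ 2) * (u t - U t) + -(ε ^ 2 * A t) := fun t => by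
    linear_combination hode t + hroot t
  have hr : ∀ t, |-(ε ^ 2 * A t)| ≤ ε ^ 2 * K := fun t => by
    rw [abs_neg, abs_mul, abs_of_pos hε2]
    exact mul_le_mul_of_nonneg_left (hx t) hε2.le
  have hq : ∀ t, m ≤ u t ^ 2 + u t * U t + U t ^ 2 - 3 * a ^ 2 := fun t =>
    le_dividedDifference ha (hua t).le (hUI t).2 hap
  have hwN : ∀ t, |u t - U t| ≤ N * ε ^ 2 := fun t => by
    have h := abs_le_div_of_periodic two_pi_pos hε2 hm hw hv
      (fun t => by simp only [huper t, hUper t]) hq hr heq t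
    rwa [mul_div_assoc, mul_comm] at h
  have hz : ∀ t, |deriv (deriv u) t - A t| ≤ B := fun t => by
    have hqt : |u t ^ 2 + u t * U t + U t ^ 2 - 3 * a ^ 2| ≤ 3 * (L + N) ^ 2 := by
      rw [abs_of_nonneg (hm.le.trans (hq t))]
      have h1 : N * ε ^ 2 ≤ N := mul_le_of_le_one_right hN (pow_le_one₀ hε.le hε1)
      have h2 := (abs_le.1 (hwN t)).1
      have h3 := (hUI t).1
      have h4 := (hUI t).2
      have h5 := hua t
      have h6 : -(L + N) ≤ u t := by linarith
      have h7 : -(L + N) ≤ U t := by linarith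
      have h8 : u t ^ 2 ≤ (L + N) ^ 2 := by nlinarith
      have h9 : U t ^ 2 ≤ (L + N) ^ 2 := by nlinarith
      nlinarith [sq_nonneg (u t - U t), sq_nonneg a]
    refine le_of_mul_le_mul_left ?_ hε2
    calc ε ^ 2 * |deriv (deriv u) t - A t| = |ε ^ 2 * (deriv (deriv u) t - A t)| := by
          rw [abs_mul, abs_of_pos hε2]
      _ ≤ |u t ^ 2 + u t * U t + U t ^ 2 - 3 * a ^ 2| * |u t - U t| + |-(ε ^ 2 * A t)| := by
          rw [heq t, ← abs_mul]; exact abs_add_le _ _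
      _ ≤ 3 * (L + N) ^ 2 * (N * ε ^ 2) + ε ^ 2 * K :=
          add_le_add (mul_le_mul hqt (hwN t) (abs_nonneg _) (by positivity)) (hr t)
      _ = ε ^ 2 * B := by simp only [B]; ring
  intro t
  rw [(hUV t).deriv]
  have h1 := abs_deriv_le_of_abs_le hε hw hv hwN hz t
  exact ⟨by linarith [hwN t], by linarith⟩

/-- The greatest root of `x ^ 3 - lam * x + cos t` is the reflected least root half a period
later. -/
theorem greatest_root_eq_neg_least_root {lam : ℝ} {Ulow Ubar : ℝ → ℝ}
    (hUlow : ∀ t : ℝ, (Ulow t) ^ 3 - lam * Ulow t + cos t = 0 ∧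
      ∀ y : ℝ, y ^ 3 - lam * y + cos t = 0 → Ulow t ≤ y)
    (hUbar : ∀ t : ℝ, (Ubar t) ^ 3 - lam * Ubar t + cos t = 0 ∧
      ∀ y : ℝ, y ^ 3 - lam * y + cos t = 0 → y ≤ Ubar t) (t : ℝ) :
    Ubar t = -Ulow (t + π) := by
  have h1 := (hUlow (t + π)).2 (-Ubar t) (by rw [cos_add_pi]; linear_combination -(hUbar t).1)
  have h2 := (hUbar t).2 (-Ulow (t + π)) (by
    have h := (hUlow (t + π)).1
    rw [cos_add_pi] at h
    linear_combination -h)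
  linarith

/-- In terms of `a = √(lam / 3)`, the condition `lam > 3 / 2 ^ (2 / 3)` reads `2 * a ^ 3 > 1`. -/
theorem one_lt_two_mul_sqrt_pow {lam : ℝ} (hlam : (3 : ℝ) / (2 : ℝ) ^ ((2 : ℝ) / 3) < lam) :
    0 < √(lam / 3) ∧ 1 < 2 * √(lam / 3) ^ 3 := by
  set k := (2 : ℝ) ^ ((2 : ℝ) / 3)
  have hk : 0 < k := by positivity
  have hk3 : k ^ 3 = 4 := by
    rw [← rpow_natCast, ← rpow_mul (by norm_num)]; norm_num
  have hpos : 0 < lam := (by positivity : 0 < 3 / k).trans hlam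
  have ha : 0 < √(lam / 3) := sqrt_pos.2 (by positivity)
  have hsq : √(lam / 3) ^ 2 = lam / 3 := sq_sqrt (by positivity)
  refine ⟨ha, ?_⟩
  set a := √(lam / 3)
  have h1 : 1 < a ^ 2 * k := by
    have := (div_lt_iff₀ hk).1 hlam
    rw [hsq]; linarith
  have h2 : 1 < (a ^ 2 * k) ^ 3 := one_lt_pow₀ h1 (by norm_num)
  rw [mul_pow, hk3] at h2
  refine lt_of_pow_lt_pow_left₀ 2 (by positivity) ?_
  linarith [h2, show (2 * a ^ 3) ^ 2 = (a ^ 2) ^ 3 * 4 by ring]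

/-- Asymptotics of the minimal and maximal periodic solutions: for
`λ > λ₀ = 3/2^(2/3)`, with `U̲(t)` and `Ū(t)` the least and greatest roots of
`x³ − λx + cos t = 0`, there exist `ε₀, M₀, M₀' > 0` so that for `0 < ε ≤ ε₀`
the `2π`-periodic solution `u₁` with `u₁ < −√(λ/3)` everywhere and
`u₅(t) = −u₁(t+π)` satisfy `|u₁ − U̲| < M₀ε²`, `|u₅ − Ū| < M₀ε²`,
`|u₁' − U̲'| < M₀'ε` and `|u₅' − Ū'| < M₀'ε` on all of `ℝ`. -/
theorem stmt_13 (lam : ℝ)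
    (hlam : (3 : ℝ) / (2 : ℝ) ^ ((2 : ℝ) / 3) < lam)
    (Ulow Ubar : ℝ → ℝ)
    (hUlow : ∀ t : ℝ, (Ulow t) ^ 3 - lam * Ulow t + Real.cos t = 0 ∧
      ∀ y : ℝ, y ^ 3 - lam * y + Real.cos t = 0 → Ulow t ≤ y)
    (hUbar : ∀ t : ℝ, (Ubar t) ^ 3 - lam * Ubar t + Real.cos t = 0 ∧
      ∀ y : ℝ, y ^ 3 - lam * y + Real.cos t = 0 → y ≤ Ubar t) :
    ∃ ε₀ > (0 : ℝ), ∃ M₀ > (0 : ℝ), ∃ M₀' > (0 : ℝ), ∀ ε ∈ Ioc (0 : ℝ) ε₀,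
      ∀ u₁ : ℝ → ℝ, ContDiff ℝ 2 u₁ →
        (∀ t : ℝ, ε ^ 2 * deriv (deriv u₁) t = u₁ t ^ 3 - lam * u₁ t + Real.cos t) →
        Function.Periodic u₁ (2 * π) →
        (∀ t : ℝ, u₁ t < -Real.sqrt (lam / 3)) →
        ∀ t : ℝ,
          |u₁ t - Ulow t| < M₀ * ε ^ 2 ∧
          |(-u₁ (t + π)) - Ubar t| < M₀ * ε ^ 2 ∧
          |deriv u₁ t - deriv Ulow t| < M₀' * ε ∧
          |deriv (fun s => -u₁ (s + π)) t - deriv Ubar t| < M₀' * ε := by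
  obtain ⟨ha, ha1⟩ := one_lt_two_mul_sqrt_pow hlam
  have hpos : 0 < lam / 3 := sqrt_pos.1 ha
  have hl : lam = 3 * √(lam / 3) ^ 2 := by rw [sq_sqrt hpos.le]; ring
  have hbar := funext (greatest_root_eq_neg_least_root hUlow hUbar)
  obtain ⟨M, hM, M', hM', h⟩ := exists_bound_sub_least_root (U := Ulow) ha ha1
    (fun t => by rw [← hl]; exact (hUlow t).1) (fun t => by rw [← hl]; exact (hUlow t).2)
  refine ⟨1, one_pos, M, hM, M', hM', fun ε hε u hu hode huper hua t => ?_⟩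
  have hu' := h ε hε u hu (by rw [← hl]; exact hode) huper hua
  refine ⟨(hu' t).1, ?_, (hu' t).2, ?_⟩
  · rw [hbar, ← abs_neg]
    convert (hu' (t + π)).1 using 2
    ring
  · rw [hbar, deriv.fun_neg, deriv.fun_neg, deriv_comp_add_const, deriv_comp_add_const, ← abs_neg]
    convert (hu' (t + π)).2 using 2
    ring
end

section
/- Let λ > λ₀, set K := √(Ū(0) − √(λ/3)) and M₁ := 2·(Ū(π) − √(λ/3)). For every sufficiently small μ > 0 there exists ε_μ ∈ (0, 1) such that for all ε ∈ (0, ε_μ): if u is a solution of (∗) on [c, d] with u(t) > √(λ/3) for all t ∈ [c, d], then |u(t) − u₅(t)| + (ε/(2K))·|u'(t) − u₅'(t)| ≤ M₁·e^{−Kμ/ε} for all t ∈ [c + μ, d − μ]; and if instead u(t) ≤ −√(λ/3) for all t ∈ [c, d], then |u(t) − u₁(t)| + (ε/(2K))·|u'(t) − u₁'(t)| ≤ M₁·e^{−Kμ/ε} for all t ∈ [c + μ, d − μ]. -/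
open Real Set Filter Topology

/-- A function that is nonpositive at both ends of an interval, and has positive second derivative
wherever it is positive, is nonpositive on the whole interval. -/
theorem nonpos_of_deriv_deriv_pos {φ : ℝ → ℝ} {a b : ℝ} (hcont : ContinuousOn φ (Icc a b))
    (ha : φ a ≤ 0) (hb : φ b ≤ 0)
    (hpos : ∀ t ∈ Ioo a b, 0 < φ t → 0 < deriv (deriv φ) t) :
    ∀ t ∈ Icc a b, φ t ≤ 0 := by
  intro t ht
  obtain ⟨m, hm, hmax⟩ := isCompact_Icc.exists_isMaxOn ⟨t, ht⟩ hcont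
  refine (hmax ht).trans ?_
  by_contra! hφm
  have hmI : m ∈ Ioo a b :=
    ⟨hm.1.lt_of_ne (by rintro rfl; linarith), hm.2.lt_of_ne (by rintro rfl; linarith)⟩
  have hnhds : Icc a b ∈ 𝓝 m := Icc_mem_nhds hmI.1 hmI.2
  have hlmax : IsLocalMax φ m := hmax.isLocalMax hnhds
  have hdd := hpos m hmI hφm
  have hlmin : IsLocalMin φ m :=
    isLocalMin_of_deriv_deriv_pos hdd hlmax.deriv_eq_zero (hcont.continuousAt hnhds)
  have hconst : φ =ᶠ[𝓝 m] fun _ => φ m := by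
    filter_upwards [hlmax, hlmin] with s h₁ h₂ using le_antisymm h₁ h₂
  have h0 := hconst.deriv.deriv_eq
  simp at h0
  linarith

theorem deriv_deriv_sub_eq {w B B' : ℝ → ℝ} {t B'' : ℝ} (hw : ContDiff ℝ 2 w)
    (hB : ∀ᶠ s in 𝓝 t, HasDerivAt B (B' s) s) (hB' : HasDerivAt B' B'' t) :
    deriv (deriv fun s => w s - B s) t = deriv (deriv w) t - B'' := by
  have hw1 : Differentiable ℝ w := hw.differentiable (by norm_num)
  have hw2 : Differentiable ℝ (deriv w) := hw.differentiable_deriv_two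
  have h : (deriv fun s => w s - B s) =ᶠ[𝓝 t] fun s => deriv w s - B' s := by
    filter_upwards [hB] with s hs using ((hw1 s).hasDerivAt.sub hs).deriv
  rw [h.deriv_eq]
  exact ((hw2 t).hasDerivAt.sub hB').deriv

/-- Keller–Osserman type estimate: `ε² w'' ≥ w³` where `w > 0` bounds `w` from above by a barrier
that blows up at the ends of the interval, independently of the boundary values of `w`. -/
theorem le_of_cube_le_deriv_deriv {w : ℝ → ℝ} {ε μ t₀ : ℝ} (hε : 0 < ε) (hμ : 0 < μ)
    (hw : ContDiff ℝ 2 w)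
    (h : ∀ t ∈ Icc (t₀ - μ) (t₀ + μ), 0 < w t → w t ^ 3 ≤ ε ^ 2 * deriv (deriv w) t) :
    ∀ t, |t - t₀| ≤ 9 / 10 * μ → w t ≤ 32 * ε / μ := by
  obtain ⟨W, hW⟩ := isCompact_Icc.exists_bound_of_continuousOn
    (hw.continuous.continuousOn (s := Icc (t₀ - μ) (t₀ + μ)))
  have hW0 : 0 ≤ W := (norm_nonneg _).trans (hW t₀ ⟨by linarith, by linarith⟩)
  obtain ⟨m, hμm, hm2, hmW⟩ : ∃ m, μ < m ∧ m ≤ 2 * μ ∧ (m - μ) * W ≤ 3 / 2 * ε := by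
    refine ⟨μ + min μ (3 / 2 * ε / (W + 1)), ?_, ?_, ?_⟩
    · have : 0 < min μ (3 / 2 * ε / (W + 1)) := lt_min hμ (by positivity)
      linarith
    · have := min_le_left μ (3 / 2 * ε / (W + 1))
      linarith
    · have h1 := min_le_right μ (3 / 2 * ε / (W + 1))
      rw [le_div_iff₀ (by positivity)] at h1
      have : 0 < min μ (3 / 2 * ε / (W + 1)) := lt_min hμ (by positivity)
      nlinarith
  have hm0 : 0 < m := hμ.trans hμm
  have hD : ∀ t ∈ Icc (t₀ - μ) (t₀ + μ), 0 < m ^ 2 - (t - t₀) ^ 2 := by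
    intro t ht
    nlinarith [ht.1, ht.2]
  have hderiv : ∀ t ∈ Icc (t₀ - μ) (t₀ + μ),
      HasDerivAt (fun s => 3 * ε * m / (m ^ 2 - (s - t₀) ^ 2))
        (6 * ε * m * (t - t₀) / (m ^ 2 - (t - t₀) ^ 2) ^ 2) t := by
    intro t ht
    have hne := (hD t ht).ne'
    have h1 : HasDerivAt (fun s => m ^ 2 - (s - t₀) ^ 2) (-(2 * (t - t₀))) t := by
      simpa using (((hasDerivAt_id t).sub_const t₀).pow 2).const_sub (m ^ 2)
    refine ((hasDerivAt_const t (3 * ε * m)).div h1 hne).congr_deriv ?_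
    ring
  have hderiv2 : ∀ t ∈ Icc (t₀ - μ) (t₀ + μ),
      HasDerivAt (fun s => 6 * ε * m * (s - t₀) / (m ^ 2 - (s - t₀) ^ 2) ^ 2)
        (6 * ε * m * (m ^ 2 + 3 * (t - t₀) ^ 2) / (m ^ 2 - (t - t₀) ^ 2) ^ 3) t := by
    intro t ht
    have hne := (hD t ht).ne'
    have h1 : HasDerivAt (fun s => m ^ 2 - (s - t₀) ^ 2) (-(2 * (t - t₀))) t := by
      simpa using (((hasDerivAt_id t).sub_const t₀).pow 2).const_sub (m ^ 2)
    have h2 : HasDerivAt (fun s => 6 * ε * m * (s - t₀)) (6 * ε * m) t := by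
      simpa using ((hasDerivAt_id t).sub_const t₀).const_mul (6 * ε * m)
    refine (h2.div (h1.pow 2) (pow_ne_zero 2 hne)).congr_deriv ?_
    simp only [Pi.pow_apply, Nat.cast_ofNat, Nat.reduceSub, pow_one]
    field_simp
    ring
  have hend : ∀ t ∈ Icc (t₀ - μ) (t₀ + μ), (t - t₀) ^ 2 = μ ^ 2 →
      w t - 3 * ε * m / (m ^ 2 - (t - t₀) ^ 2) ≤ 0 := by
    intro t ht hs
    have hwt : w t ≤ W := (le_abs_self _).trans (hW t ht)
    rw [sub_nonpos, le_div_iff₀ (hD t ht), hs]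
    have h1 : w t * (m ^ 2 - μ ^ 2) ≤ W * (m ^ 2 - μ ^ 2) :=
      mul_le_mul_of_nonneg_right hwt (by nlinarith)
    have h2 : (m - μ) * W * (m + μ) ≤ 3 / 2 * ε * (m + μ) :=
      mul_le_mul_of_nonneg_right hmW (by linarith)
    nlinarith
  have key := nonpos_of_deriv_deriv_pos (φ := fun s => w s - 3 * ε * m / (m ^ 2 - (s - t₀) ^ 2))
    (hw.continuous.continuousOn.sub fun t ht => (hderiv t ht).continuousAt.continuousWithinAt)
    (hend _ ⟨le_rfl, by linarith⟩ (by ring)) (hend _ ⟨by linarith, le_rfl⟩ (by ring)) (by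
      intro t ht hpos
      have ht' := Ioo_subset_Icc_self ht
      rw [deriv_deriv_sub_eq hw
        (by filter_upwards [Icc_mem_nhds ht.1 ht.2] with s hs using hderiv s hs) (hderiv2 t ht')]
      have hDt := hD t ht'
      have hBpos : 0 < 3 * ε * m / (m ^ 2 - (t - t₀) ^ 2) := by positivity
      have hlt : 3 * ε * m / (m ^ 2 - (t - t₀) ^ 2) < w t := by linarith
      have hcube := h t ht' (hBpos.trans hlt)
      have hlt3 := pow_lt_pow_left₀ hlt hBpos.le three_ne_zero
      have hle : ε ^ 2 * (6 * ε * m * (m ^ 2 + 3 * (t - t₀) ^ 2) / (m ^ 2 - (t - t₀) ^ 2) ^ 3)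
          ≤ (3 * ε * m / (m ^ 2 - (t - t₀) ^ 2)) ^ 3 := by
        rw [div_pow, mul_div_assoc', div_le_div_iff_of_pos_right (by positivity)]
        have : 0 ≤ ε ^ 3 * m * (m ^ 2 - (t - t₀) ^ 2) := by positivity
        have : 0 ≤ ε ^ 3 * m ^ 3 := by positivity
        nlinarith
      have : 0 < ε ^ 2 * (deriv (deriv w) t -
          6 * ε * m * (m ^ 2 + 3 * (t - t₀) ^ 2) / (m ^ 2 - (t - t₀) ^ 2) ^ 3) := by
        rw [mul_sub]; linarith
      exact pos_of_mul_pos_right this (by positivity))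
  intro t ht
  have hs := abs_le.1 ht
  have htI : t ∈ Icc (t₀ - μ) (t₀ + μ) := ⟨by linarith, by linarith⟩
  have h1 : w t ≤ 3 * ε * m / (m ^ 2 - (t - t₀) ^ 2) := sub_nonpos.1 (key t htI)
  refine h1.trans ?_
  rw [div_le_div_iff₀ (hD t htI) hμ]
  have h2 : (t - t₀) ^ 2 ≤ 81 / 100 * μ ^ 2 := by nlinarith
  have h3 : 3 * m * μ ≤ 32 * (m ^ 2 - (t - t₀) ^ 2) := by nlinarith
  nlinarith

/-- Exponential decay away from the boundary for `ε² w'' ≥ κ² w`. -/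
theorem le_exp_of_le_deriv_deriv {w : ℝ → ℝ} {ε κ r t₀ : ℝ} (hε : 0 < ε) (hκ : 0 < κ)
    (hw : ContDiff ℝ 2 w) (hl : w (t₀ - r) ≤ 1) (hu : w (t₀ + r) ≤ 1)
    (h : ∀ t ∈ Icc (t₀ - r) (t₀ + r), 0 < w t → κ ^ 2 * w t ≤ ε ^ 2 * deriv (deriv w) t) :
    ∀ t ∈ Icc (t₀ - r) (t₀ + r), w t ≤ 2 * exp (-(κ * (r - |t - t₀|)) / ε) := by
  have hE : ∀ (σ k t : ℝ), HasDerivAt (fun s => k * exp (κ * (σ * (s - t₀) - r) / ε))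
      (k * (κ * σ / ε) * exp (κ * (σ * (t - t₀) - r) / ε)) t := by
    intro σ k t
    have h1 : HasDerivAt (fun s => κ * (σ * (s - t₀) - r) / ε) (κ * σ / ε) t := by
      simpa using
        (((((hasDerivAt_id t).sub_const t₀).const_mul σ).sub_const r).const_mul κ).div_const ε
    refine (h1.exp.const_mul k).congr_deriv ?_
    ring
  set B : ℝ → ℝ := fun s =>
    1 * exp (κ * (1 * (s - t₀) - r) / ε) + 1 * exp (κ * (-1 * (s - t₀) - r) / ε) with hBdef
  have hB1 : ∀ t, HasDerivAt B _ t := fun t => (hE 1 1 t).add (hE (-1) 1 t)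
  have hB2 : ∀ t, HasDerivAt _ _ t := fun t =>
    (hE 1 (1 * (κ * 1 / ε)) t).add (hE (-1) (1 * (κ * -1 / ε)) t)
  have hBpos : ∀ t, 0 < B t := fun t => by simp only [hBdef]; positivity
  have key := nonpos_of_deriv_deriv_pos (φ := fun s => w s - B s)
    (a := t₀ - r) (b := t₀ + r)
    (hw.continuous.continuousOn.sub fun t _ => (hB1 t).continuousAt.continuousWithinAt)
    (by
      have : B (t₀ - r) = exp (κ * (1 * (t₀ - r - t₀) - r) / ε) + 1 := by simp [hBdef]
      have := exp_pos (κ * (1 * (t₀ - r - t₀) - r) / ε)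
      linarith)
    (by
      have : B (t₀ + r) = 1 + exp (κ * (-1 * (t₀ + r - t₀) - r) / ε) := by simp [hBdef]
      have := exp_pos (κ * (-1 * (t₀ + r - t₀) - r) / ε)
      linarith)
    (by
      intro t ht hpos
      rw [deriv_deriv_sub_eq hw (Eventually.of_forall hB1) (hB2 t)]
      have hlt : B t < w t := by linarith
      have h1 := h t (Ioo_subset_Icc_self ht) ((hBpos t).trans hlt)
      have h2 : κ ^ 2 * B t < κ ^ 2 * w t := by gcongr
      refine pos_of_mul_pos_right (a := ε ^ 2) ?_ (by positivity)
      rw [mul_sub]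
      refine sub_pos.2 (lt_of_eq_of_lt ?_ (h2.trans_le h1))
      simp only [hBdef]
      field_simp)
  intro t ht
  have h1 : w t ≤ B t := sub_nonpos.1 (key t ht)
  refine h1.trans ?_
  have hle : ∀ σ : ℝ, σ * (t - t₀) ≤ |t - t₀| →
      exp (κ * (σ * (t - t₀) - r) / ε) ≤ exp (-(κ * (r - |t - t₀|)) / ε) := by
    intro σ hσ
    gcongr
    nlinarith
  have := hle 1 (by rw [one_mul]; exact le_abs_self _)
  have := hle (-1) (by rw [neg_one_mul]; exact neg_le_abs _)
  simp only [hBdef]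
  linarith

/-- If `w'' = q w` with `q ≥ 0` and `w w' ≥ 0` at the left end, then `w` grows at least linearly. -/
theorem abs_deriv_mul_le_of_mul_nonneg {w w' q : ℝ → ℝ} {a b : ℝ} (hab : a ≤ b)
    (hw : ∀ t, HasDerivAt w (w' t) t) (hw' : ∀ t ∈ Icc a b, HasDerivAt w' (q t * w t) t)
    (hq : ∀ t ∈ Icc a b, 0 ≤ q t) (h0 : 0 ≤ w a * w' a) :
    |w' a| * (b - a) ≤ |w b| := by
  have hsubset : interior (Icc a b) ⊆ Icc a b := interior_subset
  have haI : a ∈ Icc a b := left_mem_Icc.2 hab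
  have hd1 : ∀ t ∈ Icc a b,
      HasDerivAt (fun s => w s * w' s) (w' t * w' t + w t * (q t * w t)) t :=
    fun t ht => (hw t).mul (hw' t ht)
  have mono1 : MonotoneOn (fun s => w s * w' s) (Icc a b) :=
    monotoneOn_of_hasDerivWithinAt_nonneg (convex_Icc a b)
      (fun t ht => (hd1 t ht).continuousAt.continuousWithinAt)
      (fun t ht => (hd1 t (hsubset ht)).hasDerivWithinAt)
      (fun t ht => by nlinarith [mul_self_nonneg (w' t), mul_nonneg (hq t (hsubset ht)) (mul_self_nonneg (w t))])
  have hnn : ∀ t ∈ Icc a b, 0 ≤ w t * w' t := fun t ht => h0.trans (mono1 haI ht ht.1)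
  have hd2 : ∀ t ∈ Icc a b, HasDerivAt (fun s => w' s ^ 2) (2 * w' t * (q t * w t)) t :=
    fun t ht => ((hw' t ht).pow 2).congr_deriv (by simp)
  have mono2 : MonotoneOn (fun s => w' s ^ 2) (Icc a b) :=
    monotoneOn_of_hasDerivWithinAt_nonneg (convex_Icc a b)
      (fun t ht => (hd2 t ht).continuousAt.continuousWithinAt)
      (fun t ht => (hd2 t (hsubset ht)).hasDerivWithinAt)
      (fun t ht => by nlinarith [mul_nonneg (hq t (hsubset ht)) (hnn t (hsubset ht))])
  have hd3 : ∀ t ∈ Icc a b, HasDerivAt (fun s => w s * w' s - w' a ^ 2 * (s - a))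
      (w' t * w' t + w t * (q t * w t) - w' a ^ 2) t :=
    fun t ht => ((hd1 t ht).sub
      (((hasDerivAt_id t).sub_const a).const_mul (w' a ^ 2))).congr_deriv (by simp)
  have mono3 : MonotoneOn (fun s => w s * w' s - w' a ^ 2 * (s - a)) (Icc a b) :=
    monotoneOn_of_hasDerivWithinAt_nonneg (convex_Icc a b)
      (fun t ht => (hd3 t ht).continuousAt.continuousWithinAt)
      (fun t ht => (hd3 t (hsubset ht)).hasDerivWithinAt)
      (fun t ht => by
        have h2 : w' a ^ 2 ≤ w' t ^ 2 := mono2 haI (hsubset ht) (hsubset ht).1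
        nlinarith [mul_nonneg (hq t (hsubset ht)) (mul_self_nonneg (w t))])
  have hd4 : ∀ t, HasDerivAt (fun s => w s ^ 2 - w' a ^ 2 * (s - a) ^ 2)
      (2 * w t * w' t - w' a ^ 2 * (2 * (t - a))) t :=
    fun t => (((hw t).pow 2).sub
      ((((hasDerivAt_id t).sub_const a).pow 2).const_mul (w' a ^ 2))).congr_deriv (by simp)
  have mono4 : MonotoneOn (fun s => w s ^ 2 - w' a ^ 2 * (s - a) ^ 2) (Icc a b) :=
    monotoneOn_of_hasDerivWithinAt_nonneg (convex_Icc a b)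
      (fun t _ => (hd4 t).continuousAt.continuousWithinAt)
      (fun t _ => (hd4 t).hasDerivWithinAt)
      (fun t ht => by
        have h3 : w a * w' a - w' a ^ 2 * (a - a) ≤ w t * w' t - w' a ^ 2 * (t - a) :=
          mono3 haI (hsubset ht) (hsubset ht).1
        simp only [sub_self, mul_zero, sub_zero] at h3
        linarith)
  have h4 : w a ^ 2 - w' a ^ 2 * (a - a) ^ 2 ≤ w b ^ 2 - w' a ^ 2 * (b - a) ^ 2 :=
    mono4 haI (right_mem_Icc.2 hab) hab
  rw [← abs_of_nonneg (sub_nonneg.2 hab), ← abs_mul]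
  apply sq_le_sq.1
  nlinarith [sq_nonneg (w a)]

/-- Interior derivative bound for solutions of `w'' = q w` with `q ≥ 0`. -/
theorem abs_deriv_mul_le {w w' q : ℝ → ℝ} {t₀ h δ : ℝ} (hh : 0 ≤ h)
    (hw : ∀ t, HasDerivAt w (w' t) t)
    (hw' : ∀ t ∈ Icc (t₀ - h) (t₀ + h), HasDerivAt w' (q t * w t) t)
    (hq : ∀ t ∈ Icc (t₀ - h) (t₀ + h), 0 ≤ q t)
    (hl : |w (t₀ - h)| ≤ δ) (hu : |w (t₀ + h)| ≤ δ) :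
    |w' t₀| * h ≤ δ := by
  rcases le_total 0 (w t₀ * w' t₀) with h0 | h0
  · have := abs_deriv_mul_le_of_mul_nonneg (a := t₀) (b := t₀ + h) (by linarith) hw
      (fun t ht => hw' t ⟨by linarith [ht.1], ht.2⟩)
      (fun t ht => hq t ⟨by linarith [ht.1], ht.2⟩) h0
    rw [add_sub_cancel_left] at this
    exact this.trans hu
  · have hmem : ∀ t ∈ Icc (-t₀) (-t₀ + h), -t ∈ Icc (t₀ - h) (t₀ + h) :=
      fun t ht => ⟨by linarith [ht.2], by linarith [ht.1]⟩
    have := abs_deriv_mul_le_of_mul_nonneg (w := fun t => w (-t)) (w' := fun t => -w' (-t))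
      (q := fun t => q (-t)) (a := -t₀) (b := -t₀ + h) (by linarith)
      (fun t => ((hw (-t)).comp t (hasDerivAt_neg t)).congr_deriv (by ring))
      (fun t ht => ((hw' (-t) (hmem t ht)).comp t (hasDerivAt_neg t)).neg.congr_deriv (by ring))
      (fun t ht => hq (-t) (hmem t ht)) (by simpa using h0)
    rw [add_sub_cancel_left] at this
    simp only [neg_neg, abs_neg, neg_add_rev] at this
    exact this.trans (by rwa [add_comm, ← sub_eq_add_neg])

/-- A difference of two solutions is exponentially small, together with its derivative, at the
centre of an interval of radius `μ`, with no bound on its boundary values assumed. -/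
theorem abs_add_abs_deriv_le_exp {w q : ℝ → ℝ} {ε μ K M t₀ : ℝ} (hε : 0 < ε) (hμ : 0 < μ)
    (hK : 0 < K) (hM : 0 < M) (hε₁ : ε ≤ μ / 32) (hε₂ : ε ≤ K * μ / 10)
    (hε₃ : ε ≤ K * μ * M / 15) (hw : ContDiff ℝ 2 w)
    (hode : ∀ t ∈ Icc (t₀ - μ) (t₀ + μ), ε ^ 2 * deriv (deriv w) t = q t * w t)
    (hqw : ∀ t ∈ Icc (t₀ - μ) (t₀ + μ), w t ^ 2 ≤ q t)
    (hqK : ∀ t ∈ Icc (t₀ - μ) (t₀ + μ), (3 / 2 * K) ^ 2 ≤ q t) :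
    |w t₀| + ε / (2 * K) * |deriv w t₀| ≤ M * exp (-(K * μ) / ε) := by
  have hone : 32 * ε / μ ≤ 1 := by rw [div_le_one hμ]; linarith
  have hdneg : ∀ t, deriv (deriv fun s => -w s) t = -deriv (deriv w) t := fun t => by
    simp [deriv.fun_neg']
  have hup : ∀ t, |t - t₀| ≤ 9 / 10 * μ → w t ≤ 1 := fun t ht =>
    (le_of_cube_le_deriv_deriv hε hμ hw (fun s hs hp => by
      rw [hode s hs]; nlinarith [hqw s hs]) t ht).trans hone
  have hlo : ∀ t, |t - t₀| ≤ 9 / 10 * μ → -w t ≤ 1 := fun t ht =>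
    (le_of_cube_le_deriv_deriv hε hμ hw.neg (fun s hs hp => by
      rw [hdneg, mul_neg, hode s hs]; nlinarith [hqw s hs]) t ht).trans hone
  have hsub : ∀ t ∈ Icc (t₀ - 9 / 10 * μ) (t₀ + 9 / 10 * μ), t ∈ Icc (t₀ - μ) (t₀ + μ) :=
    fun t ht => ⟨by linarith [ht.1], by linarith [ht.2]⟩
  have hr : 0 < 9 / 10 * μ := by positivity
  have hal : |t₀ - 9 / 10 * μ - t₀| ≤ 9 / 10 * μ := by
    rw [sub_sub_cancel_left, abs_neg, abs_of_pos hr]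
  have hau : |t₀ + 9 / 10 * μ - t₀| ≤ 9 / 10 * μ := by
    rw [add_sub_cancel_left, abs_of_pos hr]
  have hup' := le_exp_of_le_deriv_deriv hε (κ := 3 / 2 * K) (by positivity) hw
    (hup _ hal) (hup _ hau) (fun s hs hp => by
      rw [hode s (hsub s hs)]
      exact mul_le_mul_of_nonneg_right (hqK s (hsub s hs)) hp.le)
  have hlo' := le_exp_of_le_deriv_deriv hε (κ := 3 / 2 * K) (by positivity) hw.neg
    (hlo _ hal) (hlo _ hau) (fun s hs hp => by
      rw [hdneg, mul_neg (ε ^ 2), hode s (hsub s hs), ← mul_neg]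
      exact mul_le_mul_of_nonneg_right (hqK s (hsub s hs)) hp.le)
  set X := K * μ / ε with hX
  have hδ : ∀ t, |t - t₀| ≤ μ / 10 → |w t| ≤ 2 * exp (-(6 / 5 * X)) := by
    intro t ht
    have hs := abs_le.1 ht
    have hI : t ∈ Icc (t₀ - 9 / 10 * μ) (t₀ + 9 / 10 * μ) := ⟨by linarith, by linarith⟩
    have hexp : 2 * exp (-(3 / 2 * K * (9 / 10 * μ - |t - t₀|)) / ε) ≤
        2 * exp (-(6 / 5 * X)) := by
      have : -(6 / 5 * X) = -(6 / 5 * (K * μ)) / ε := by rw [hX]; ring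
      rw [this]
      gcongr ?_ * exp (?_ / ε)
      nlinarith [mul_nonneg hK.le (sub_nonneg.2 ht)]
    exact abs_le'.2 ⟨(hup' t hI).trans hexp, (hlo' t hI).trans hexp⟩
  have hw1 : Differentiable ℝ w := hw.differentiable (by norm_num)
  have hw2 : Differentiable ℝ (deriv w) := hw.differentiable_deriv_two
  have hsub' : ∀ t ∈ Icc (t₀ - μ / 10) (t₀ + μ / 10), t ∈ Icc (t₀ - μ) (t₀ + μ) :=
    fun t ht => ⟨by linarith [ht.1], by linarith [ht.2]⟩
  have hder := abs_deriv_mul_le (w := w) (q := fun t => q t / ε ^ 2) (h := μ / 10) (by positivity)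
    (fun t => (hw1 t).hasDerivAt)
    (fun t ht => by
      have h1 : q t / ε ^ 2 * w t = deriv (deriv w) t := by
        have := hode t (hsub' t ht)
        field_simp
        linarith
      rw [h1]
      exact (hw2 t).hasDerivAt)
    (fun t ht => div_nonneg ((sq_nonneg _).trans (hqw t (hsub' t ht))) (by positivity))
    (hδ _ (by rw [sub_sub_cancel_left, abs_neg, abs_of_pos (by positivity)]))
    (hδ _ (by rw [add_sub_cancel_left, abs_of_pos (by positivity)]))
  have hwt₀ := hδ t₀ (by simp; positivity)
  have hX10 : 10 ≤ X := by rw [hX, le_div_iff₀ hε]; linarith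
  have hXM : 15 ≤ M * X := by rw [hX, mul_div_assoc', le_div_iff₀ hε]; linarith
  have hterm : ε / (2 * K) * |deriv w t₀| ≤ exp (-(6 / 5 * X)) := by
    have h1 : ε / (2 * K) ≤ μ / 20 := by
      rw [div_le_iff₀ (by positivity)]
      linarith
    have h2 := mul_le_mul_of_nonneg_right h1 (abs_nonneg (deriv w t₀))
    linarith
  have hsplit : exp (-(6 / 5 * X)) = exp (-(X / 5)) * exp (-X) := by
    rw [← exp_add]; ring_nf
  have hsmall : 3 * exp (-(X / 5)) ≤ M := by
    rw [exp_neg, ← div_eq_mul_inv, div_le_iff₀ (exp_pos _)]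
    have := add_one_le_exp (X / 5)
    nlinarith
  have hfin : -(K * μ) / ε = -X := by rw [hX]; ring
  rw [hfin]
  have := mul_le_mul_of_nonneg_right hsmall (exp_pos (-X)).le
  linarith

/-- The greatest root of `y³ - λ y + k` lies above any point where the cubic is negative. -/
theorem lt_of_cubic_neg {lam k b r : ℝ} (hb : b ^ 3 - lam * b + k < 0)
    (hr : ∀ y : ℝ, y ^ 3 - lam * y + k = 0 → y ≤ r) : b < r := by
  set R := |b| + |lam| + |k| + 1
  have hbR : b ≤ R := by
    have := le_abs_self b
    have := abs_nonneg lam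
    have := abs_nonneg k
    linarith
  have hR : 0 ≤ R ^ 3 - lam * R + k := by
    have h1 : 1 ≤ R := by
      have := abs_nonneg b
      have := abs_nonneg lam
      have := abs_nonneg k
      linarith
    have h2 : lam + |k| ≤ R := by
      have := le_abs_self lam
      have := abs_nonneg b
      linarith
    have h3 := neg_abs_le k
    have h4 : R * R ≤ R ^ 3 := by nlinarith [mul_nonneg (sub_nonneg.2 h1) (sq_nonneg R)]
    have h5 := abs_nonneg k
    nlinarith
  obtain ⟨y, hy, hy0⟩ := intermediate_value_Icc hbR
    (f := fun y => y ^ 3 - lam * y + k) (by fun_prop) ⟨hb.le, hR⟩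
  refine lt_of_lt_of_le (hy.1.lt_of_ne ?_) (hr y hy0)
  rintro rfl
  exact hb.ne hy0

/-- A periodic solution below `-√(λ/3)` stays below `-r`, `r` the greatest root of
`y³ - λ y + 1`. -/
theorem periodic_solution_le {lam b r ε : ℝ} {u : ℝ → ℝ} (hb : 0 < b) (hlam : lam = 3 * b ^ 2)
    (hbr : b < r) (hr : r ^ 3 - lam * r + 1 = 0) (hu : ContDiff ℝ 2 u)
    (hode : ∀ t, ε ^ 2 * deriv (deriv u) t = u t ^ 3 - lam * u t + cos t)
    (hper : Function.Periodic u (2 * π)) (hub : ∀ t, u t < -b) (t : ℝ) : u t ≤ -r := by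
  obtain ⟨m, -, hmax⟩ := isCompact_Icc.exists_isMaxOn (α := ℝ) (s := Icc 0 (0 + 2 * π))
    ⟨0, by simp; positivity⟩ hu.continuous.continuousOn
  have hglob : ∀ s, u s ≤ u m := by
    intro s
    obtain ⟨y, hy, hys⟩ := hper.exists_mem_Ico₀ (by positivity) s
    rw [hys]
    exact hmax ⟨hy.1, by linarith [hy.2]⟩
  have hlmax : IsLocalMax u m := Eventually.of_forall hglob
  have hdd : deriv (deriv u) m ≤ 0 := by
    by_contra! hpos
    have hlmin := isLocalMin_of_deriv_deriv_pos hpos hlmax.deriv_eq_zero hu.continuous.continuousAt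
    have hconst : u =ᶠ[𝓝 m] fun _ => u m := by
      filter_upwards [hlmin] with s h₂ using le_antisymm (hglob s) h₂
    have h0 := hconst.deriv.deriv_eq
    simp at h0
    linarith
  refine (hglob t).trans ?_
  by_contra! hlt
  have h1 := hode m
  have h2 := neg_one_le_cos m
  have h3 : ε ^ 2 * deriv (deriv u) m ≤ 0 := mul_nonpos_of_nonneg_of_nonpos (sq_nonneg _) hdd
  have h4 := hub m
  set y := -u m with hy
  have h5 : u m = -y := by simp [hy]
  rw [h5] at h1 h4 hlt
  have hyb : b < y := by linarith
  have hyr : y < r := by linarith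
  have : 0 < (r - y) * (r ^ 2 + r * y + y ^ 2 - 3 * b ^ 2) :=
    mul_pos (by linarith) (by nlinarith)
  subst hlam
  nlinarith

/-- Exponential closeness to the extreme periodic solutions: let `λ > λ₀`,
`K = √(Ū(0) − √(λ/3))`, `M₁ = 2(Ū(π) − √(λ/3))`.  For every sufficiently small
`μ > 0` there is `ε_μ ∈ (0,1)` so that for `0 < ε < ε_μ`: any solution `u` of
the Duffing equation on `[c,d]` with `u > √(λ/3)` there satisfies
`|u − u₅| + (ε/2K)|u' − u₅'| ≤ M₁·e^{−Kμ/ε}` on `[c+μ, d−μ]`, and any solution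
with `u ≤ −√(λ/3)` on `[c,d]` satisfies the analogous estimate with `u₁`.
Here `u₁` is the `2π`-periodic solution with `u₁ < −√(λ/3)` everywhere and
`u₅(t) = −u₁(t+π)`. -/
theorem stmt_14 (lam Ubar0 Ubarpi K M₁ : ℝ)
    (hlam : (3 : ℝ) / (2 : ℝ) ^ ((2 : ℝ) / 3) < lam)
    (hUbar0root : Ubar0 ^ 3 - lam * Ubar0 + 1 = 0)
    (hUbar0great : ∀ y : ℝ, y ^ 3 - lam * y + 1 = 0 → y ≤ Ubar0)
    (hUbarpiroot : Ubarpi ^ 3 - lam * Ubarpi - 1 = 0)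
    (hUbarpigreat : ∀ y : ℝ, y ^ 3 - lam * y - 1 = 0 → y ≤ Ubarpi)
    (hK : K = Real.sqrt (Ubar0 - Real.sqrt (lam / 3)))
    (hM₁ : M₁ = 2 * (Ubarpi - Real.sqrt (lam / 3))) :
    ∃ μ₀ > (0 : ℝ), ∀ μ : ℝ, 0 < μ → μ < μ₀ →
      ∃ εμ ∈ Ioo (0 : ℝ) 1, ∀ ε : ℝ, 0 < ε → ε < εμ →
        ∀ u₁ : ℝ → ℝ, ContDiff ℝ 2 u₁ →
          (∀ t : ℝ, ε ^ 2 * deriv (deriv u₁) t = u₁ t ^ 3 - lam * u₁ t + Real.cos t) →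
          Function.Periodic u₁ (2 * π) →
          (∀ t : ℝ, u₁ t < -Real.sqrt (lam / 3)) →
          ∀ c d : ℝ, ∀ u : ℝ → ℝ, ContDiff ℝ 2 u →
            (∀ t ∈ Icc c d,
              ε ^ 2 * deriv (deriv u) t = u t ^ 3 - lam * u t + Real.cos t) →
            ((∀ t ∈ Icc c d, Real.sqrt (lam / 3) < u t) →
              ∀ t ∈ Icc (c + μ) (d - μ),
                |u t - (-u₁ (t + π))| +
                  ε / (2 * K) * |deriv u t - deriv (fun s => -u₁ (s + π)) t| ≤
                  M₁ * Real.exp (-(K * μ) / ε)) ∧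
            ((∀ t ∈ Icc c d, u t ≤ -Real.sqrt (lam / 3)) →
              ∀ t ∈ Icc (c + μ) (d - μ),
                |u t - u₁ t| + ε / (2 * K) * |deriv u t - deriv u₁ t| ≤
                  M₁ * Real.exp (-(K * μ) / ε)) := by
  set b := Real.sqrt (lam / 3) with hb_def
  have hlam0 : 0 < lam := lt_of_le_of_lt (by positivity) hlam
  have hb0 : 0 < b := Real.sqrt_pos.2 (by positivity)
  have hbsq : lam = 3 * b ^ 2 := by
    rw [hb_def, Real.sq_sqrt (by positivity)]; ring
  have hb3 : 1 / 2 < b ^ 3 := by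
    have h2 : ((2 : ℝ) ^ ((2 : ℝ) / 3)) ^ 3 = 4 := by
      rw [← Real.rpow_natCast, ← Real.rpow_mul (by norm_num)]
      norm_num
    have h3 := pow_lt_pow_left₀ hlam (by positivity) three_ne_zero
    rw [div_pow, h2, hbsq] at h3
    refine lt_of_pow_lt_pow_left₀ 2 (by positivity) ?_
    nlinarith
  have hb34 : 3 / 4 < b := by
    refine lt_of_pow_lt_pow_left₀ 3 hb0.le ?_
    linarith
  have hbU0 : b < Ubar0 := lt_of_cubic_neg (k := 1) (by rw [hbsq]; nlinarith) hUbar0great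
  have hbUpi : b < Ubarpi := lt_of_cubic_neg (lam := lam) (k := -1) (by rw [hbsq]; nlinarith)
    (by simpa only [← sub_eq_add_neg] using hUbarpigreat)
  have hK0 : 0 < K := hK ▸ Real.sqrt_pos.2 (sub_pos.2 hbU0)
  have hKsq : K ^ 2 = Ubar0 - b := by rw [hK, Real.sq_sqrt (sub_pos.2 hbU0).le]
  have hM0 : 0 < M₁ := by rw [hM₁]; linarith
  have hq : ∀ x y, b ≤ x → Ubar0 ≤ y →
      (x - y) ^ 2 ≤ x ^ 2 + x * y + y ^ 2 - lam ∧
        (3 / 2 * K) ^ 2 ≤ x ^ 2 + x * y + y ^ 2 - lam := by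
    intro x y hx hy
    rw [mul_pow, hKsq, hbsq]
    have hxy : b * b ≤ x * y := mul_le_mul hx (hbU0.le.trans hy) hb0.le (hb0.le.trans hx)
    have hxU : b * Ubar0 ≤ x * y := mul_le_mul hx hy (hb0.trans hbU0).le (hb0.le.trans hx)
    constructor <;> nlinarith
  refine ⟨1, one_pos, fun μ hμ _ => ?_⟩
  refine ⟨min (1 / 2) (min (μ / 32) (min (K * μ / 10) (K * μ * M₁ / 15))),
    ⟨by positivity, (min_le_left _ _).trans_lt (by norm_num)⟩, ?_⟩
  intro ε hε hεlt u₁ hu₁ hode₁ hper hub c d u hu hode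
  simp only [lt_min_iff] at hεlt
  obtain ⟨-, hε₁, hε₂, hε₃⟩ := hεlt
  have hu₁le := periodic_solution_le hb0 hbsq hbU0 hUbar0root hu₁ hode₁ hper hub
  have hsub : ∀ t ∈ Icc (c + μ) (d - μ), ∀ s ∈ Icc (t - μ) (t + μ), s ∈ Icc c d :=
    fun t ht s hs => ⟨by linarith [ht.1, hs.1], by linarith [ht.2, hs.2]⟩
  have hdiff : ∀ {f : ℝ → ℝ}, ContDiff ℝ 2 f → Differentiable ℝ f :=
    fun hf => hf.differentiable (by norm_num)
  have main : ∀ v : ℝ → ℝ, ContDiff ℝ 2 v →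
      (∀ t, ε ^ 2 * deriv (deriv v) t = v t ^ 3 - lam * v t + Real.cos t) →
      (∀ t ∈ Icc c d, (u t - v t) ^ 2 ≤ u t ^ 2 + u t * v t + v t ^ 2 - lam ∧
        (3 / 2 * K) ^ 2 ≤ u t ^ 2 + u t * v t + v t ^ 2 - lam) →
      ∀ t ∈ Icc (c + μ) (d - μ),
        |u t - v t| + ε / (2 * K) * |deriv u t - deriv v t| ≤
          M₁ * Real.exp (-(K * μ) / ε) := by
    intro v hv hodev hqv t ht
    have hd : (deriv fun s => u s - v s) = fun s => deriv u s - deriv v s :=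
      funext fun s => deriv_fun_sub (hdiff hu s) (hdiff hv s)
    have := abs_add_abs_deriv_le_exp (w := fun s => u s - v s)
      (q := fun s => u s ^ 2 + u s * v s + v s ^ 2 - lam) (t₀ := t) hε hμ hK0 hM0
      hε₁.le hε₂.le hε₃.le (hu.sub hv)
      (fun s hs => by
        rw [hd, deriv_fun_sub (hu.differentiable_deriv_two s)
            (hv.differentiable_deriv_two s), mul_sub, hodev,
          hode s (hsub t ht s hs)]
        ring)
      (fun s hs => (hqv s (hsub t ht s hs)).1) (fun s hs => (hqv s (hsub t ht s hs)).2)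
    rwa [hd] at this
  constructor
  · intro hup
    have hd5 : (deriv fun s => -u₁ (s + π)) = fun s => -deriv u₁ (s + π) := by
      funext s
      rw [deriv.fun_neg, deriv_comp_add_const]
    refine main (fun s => -u₁ (s + π)) (by fun_prop) (fun t => ?_) fun t ht =>
      hq _ _ (hup t ht).le (by linarith [hu₁le (t + π)])
    rw [hd5, deriv.fun_neg, deriv_comp_add_const, mul_neg, hode₁, Real.cos_add_pi]
    ring
  · intro hlow
    refine main u₁ hu₁ hode₁ fun t ht => ?_
    have := hq (-u t) (-u₁ t) (by linarith [hlow t ht]) (by linarith [hu₁le t])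
    constructor <;> nlinarith [this.1, this.2]
end
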